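/- arXiv:math/0601529 — 3 statements merged into one kernel-verified Lean document; each statement's English description precedes it below -/
import Mathlib

section
/- Let μ > 0 be a real number, let r be a real number with 0 < r < μ, and let s ∈ ℂ with Re s < 0. Then −(sin(πs)/π)·∫_r^∞ ρ^s (μ + ρ)^{-1} dρ + (r/(2π))·∫_{−π}^{π} e^{it} (r e^{it})^s (μ − r e^{it})^{-1} dt = μ^s. (Here for ρ > 0, ρ^s = exp(s·log ρ), and (r e^{it})^s denotes the principal complex power; both improper integrals converge absolutely since Re s < 0.) -/
open MeasureTheory
open scoped Real

/-- The integrand of the power integral in the logarithmic variable, with its value at the pole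
subtracted; the singularity at `log μ` is removed by means of divided slopes. -/
noncomputable def regularizedIntegrand (μ : ℝ) (s w : ℂ) : ℂ :=
  -Complex.exp w * dslope (fun z => Complex.exp (s * z)) (Real.log μ : ℂ) w *
    (dslope Complex.exp (Real.log μ : ℂ) w)⁻¹

theorem eq_log_of_exp_eq {μ : ℝ} (hμ : 0 < μ) {w : ℂ} (hw : |w.im| ≤ π)
    (h : Complex.exp w = μ) : w = (Real.log μ : ℂ) := by
  have h' : Complex.exp w = Complex.exp (Real.log μ : ℂ) := by
    rw [h, ← Complex.ofReal_exp, Real.exp_log hμ]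
  obtain ⟨n, hn⟩ := Complex.exp_eq_exp_iff_exists_int.1 h'
  have him : w.im = n * (2 * π) := by
    rw [hn]; simp
  have hn0 : n = 0 := by
    rw [him, abs_mul, abs_of_pos Real.two_pi_pos] at hw
    have h1 : |(n : ℝ)| < 1 := by
      by_contra! hc
      nlinarith [Real.pi_pos]
    have h2 : |n| < 1 := by exact_mod_cast h1
    exact Int.abs_lt_one_iff.1 h2
  simpa [hn0] using hn

theorem regularizedIntegrand_of_exp_ne {μ : ℝ} (hμ : 0 < μ) (s : ℂ) {w : ℂ}
    (hw : Complex.exp w ≠ μ) :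
    regularizedIntegrand μ s w =
      (Complex.exp (s * w) - (μ : ℂ) ^ s) * Complex.exp w * ((μ : ℂ) - Complex.exp w)⁻¹ := by
  have hexp : Complex.exp (Real.log μ : ℂ) = μ := by
    rw [← Complex.ofReal_exp, Real.exp_log hμ]
  have hne : w ≠ (Real.log μ : ℂ) := fun h => hw (h ▸ hexp)
  have hpow : Complex.exp (s * (Real.log μ : ℂ)) = (μ : ℂ) ^ s := by
    rw [Complex.cpow_def_of_ne_zero (by exact_mod_cast hμ.ne'), ← Complex.ofReal_log hμ.le,
      mul_comm]
  rw [regularizedIntegrand, dslope_of_ne _ hne, dslope_of_ne _ hne, slope_def_field,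
    slope_def_field, hexp, hpow]
  have h1 := sub_ne_zero.2 hne
  have h2 := sub_ne_zero.2 hw
  have h3 := sub_ne_zero.2 hw.symm
  field_simp
  ring

theorem differentiableAt_regularizedIntegrand {μ : ℝ} (hμ : 0 < μ) (s : ℂ) {w : ℂ}
    (hw : |w.im| ≤ π) : DifferentiableAt ℂ (regularizedIntegrand μ s) w := by
  have key : ∀ f : ℂ → ℂ, Differentiable ℂ f →
      Differentiable ℂ (dslope f (Real.log μ : ℂ)) := fun f hf =>
    differentiableOn_univ.1 ((Complex.differentiableOn_dslope Filter.univ_mem).2 hf.differentiableOn)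
  have hexp : Complex.exp (Real.log μ : ℂ) = μ := by
    rw [← Complex.ofReal_exp, Real.exp_log hμ]
  have hne : dslope Complex.exp (Real.log μ : ℂ) w ≠ 0 := by
    by_cases h : w = (Real.log μ : ℂ)
    · rw [h, dslope_same, Complex.deriv_exp]
      exact Complex.exp_ne_zero _
    · rw [dslope_of_ne _ h, slope_def_field, hexp]
      exact div_ne_zero (sub_ne_zero.2 fun h' => h (eq_log_of_exp_eq hμ hw h')) (sub_ne_zero.2 h)
  exact ((Complex.differentiable_exp.neg w).mul (key _ (by fun_prop) w)).mul
    ((key _ Complex.differentiable_exp w).inv hne)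

theorem norm_ofReal_mul_exp_I_mul {R : ℝ} (hR : 0 < R) (t : ℝ) :
    ‖(R : ℂ) * Complex.exp (Complex.I * t)‖ = R := by
  rw [norm_mul, mul_comm Complex.I, Complex.norm_exp_ofReal_mul_I, Complex.norm_real,
    Real.norm_of_nonneg hR.le, mul_one]

theorem ofReal_mul_exp_I_mul_ne {μ R : ℝ} (hμ : 0 < μ) (hR : 0 < R) (h : R ≠ μ) (t : ℝ) :
    (R : ℂ) * Complex.exp (Complex.I * t) ≠ μ := fun h' => h <| by
  rw [← norm_ofReal_mul_exp_I_mul hR t, h', Complex.norm_real, Real.norm_of_nonneg hμ.le]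

theorem integral_cauchyKernel_eq_circleIntegral (μ R : ℝ) :
    (∫ t in (-π : ℝ)..π, (R : ℂ) * Complex.exp (Complex.I * t) *
      ((μ : ℂ) - (R : ℂ) * Complex.exp (Complex.I * t))⁻¹) =
      Complex.I * circleIntegral (fun z => (z - (μ : ℂ))⁻¹) 0 R := by
  have hper : Function.Periodic (fun t : ℝ => (R : ℂ) * Complex.exp (Complex.I * t) *
      ((μ : ℂ) - (R : ℂ) * Complex.exp (Complex.I * t))⁻¹) (2 * π) := by
    intro t
    have : Complex.exp (Complex.I * ((t + 2 * π : ℝ) : ℂ)) = Complex.exp (Complex.I * t) := by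
      rw [show Complex.I * ((t + 2 * π : ℝ) : ℂ) = Complex.I * t + 2 * π * Complex.I by
        push_cast; ring, Complex.exp_periodic]
    simp only [this]
  have h := hper.intervalIntegral_add_eq (-π) 0
  rw [show -π + 2 * π = π by ring, zero_add] at h
  rw [h, circleIntegral, ← intervalIntegral.integral_const_mul]
  refine intervalIntegral.integral_congr fun t _ => ?_
  simp only [deriv_circleMap, circleMap, zero_add, smul_eq_mul, mul_comm Complex.I (t : ℂ)]
  rw [← neg_sub (μ : ℂ), inv_neg]
  linear_combination ((R : ℂ) * Complex.exp (t * Complex.I) *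
    ((μ : ℂ) - R * Complex.exp (t * Complex.I))⁻¹) * Complex.I_mul_I

theorem integral_cauchyKernel_of_lt {μ R : ℝ} (hR : 0 < R) (h : R < μ) :
    (∫ t in (-π : ℝ)..π, (R : ℂ) * Complex.exp (Complex.I * t) *
      ((μ : ℂ) - (R : ℂ) * Complex.exp (Complex.I * t))⁻¹) = 0 := by
  have hne : ∀ z ∈ Metric.closedBall (0 : ℂ) R, z - (μ : ℂ) ≠ 0 := by
    intro z hz h0
    rw [sub_eq_zero.1 h0, mem_closedBall_zero_iff, Complex.norm_real,
      Real.norm_of_nonneg (hR.trans h).le] at hz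
    linarith
  have hcircle : circleIntegral (fun z => (z - (μ : ℂ))⁻¹) 0 R = 0 :=
    Complex.circleIntegral_eq_zero_of_differentiable_on_off_countable hR.le Set.countable_empty
      (ContinuousOn.inv₀ (by fun_prop) hne) fun z hz => DifferentiableAt.inv (by fun_prop)
        (hne z (Metric.ball_subset_closedBall hz.1))
  rw [integral_cauchyKernel_eq_circleIntegral, hcircle, mul_zero]

theorem integral_cauchyKernel_of_gt {μ R : ℝ} (hμ : 0 < μ) (h : μ < R) :
    (∫ t in (-π : ℝ)..π, (R : ℂ) * Complex.exp (Complex.I * t) *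
      ((μ : ℂ) - (R : ℂ) * Complex.exp (Complex.I * t))⁻¹) = -(2 * π) := by
  rw [integral_cauchyKernel_eq_circleIntegral, circleIntegral.integral_sub_inv_of_mem_ball]
  · linear_combination (2 * π : ℂ) * Complex.I_mul_I
  · rwa [mem_ball_zero_iff, Complex.norm_real, Real.norm_of_nonneg hμ.le]

theorem cpow_ofReal_mul_exp_I_mul {R : ℝ} (hR : 0 < R) (s : ℂ) {t : ℝ} (ht : t ∈ Set.Ioc (-π) π) :
    ((R : ℂ) * Complex.exp (Complex.I * t)) ^ s =
      Complex.exp (s * ((Real.log R : ℂ) + t * Complex.I)) := by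
  rw [Complex.cpow_def_of_ne_zero
    (mul_ne_zero (by exact_mod_cast hR.ne') (Complex.exp_ne_zero _)),
    Complex.log_ofReal_mul hR (Complex.exp_ne_zero _),
    Complex.log_exp (by simpa using ht.1) (by simpa using ht.2)]
  ring_nf

theorem exp_log_add_mul_I {R : ℝ} (hR : 0 < R) (t : ℝ) :
    Complex.exp ((Real.log R : ℂ) + t * Complex.I) = R * Complex.exp (Complex.I * t) := by
  rw [Complex.exp_add, ← Complex.ofReal_exp, Real.exp_log hR, mul_comm (t : ℂ)]

theorem integral_regularizedIntegrand_vertical {μ R : ℝ} (hμ : 0 < μ) (hR : 0 < R) (h : R ≠ μ)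
    (s : ℂ) :
    (∫ t in (-π : ℝ)..π, regularizedIntegrand μ s ((Real.log R : ℂ) + t * Complex.I)) =
      R * (∫ t in (-π : ℝ)..π,
        Complex.exp (Complex.I * t) * ((R : ℂ) * Complex.exp (Complex.I * t)) ^ s *
          ((μ : ℂ) - (R : ℂ) * Complex.exp (Complex.I * t))⁻¹) -
      (μ : ℂ) ^ s * ∫ t in (-π : ℝ)..π, (R : ℂ) * Complex.exp (Complex.I * t) *
        ((μ : ℂ) - (R : ℂ) * Complex.exp (Complex.I * t))⁻¹ := by
  have hne : ∀ t : ℝ, (μ : ℂ) - (R : ℂ) * Complex.exp (Complex.I * t) ≠ 0 := fun t =>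
    sub_ne_zero.2 (ofReal_mul_exp_I_mul_ne hμ hR h t).symm
  have hle : -π ≤ π := by linarith [Real.pi_pos]
  have hJ : (∫ t in (-π : ℝ)..π,
        Complex.exp (Complex.I * t) * ((R : ℂ) * Complex.exp (Complex.I * t)) ^ s *
          ((μ : ℂ) - (R : ℂ) * Complex.exp (Complex.I * t))⁻¹) =
      ∫ t in (-π : ℝ)..π, Complex.exp (Complex.I * t) *
        Complex.exp (s * ((Real.log R : ℂ) + t * Complex.I)) *
          ((μ : ℂ) - (R : ℂ) * Complex.exp (Complex.I * t))⁻¹ := by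
    refine intervalIntegral.integral_congr_ae (Filter.Eventually.of_forall fun t ht => ?_)
    rw [Set.uIoc_of_le hle] at ht
    rw [cpow_ofReal_mul_exp_I_mul hR s ht]
  have hc : Continuous fun t : ℝ => ((μ : ℂ) - (R : ℂ) * Complex.exp (Complex.I * t))⁻¹ :=
    Continuous.inv₀ (by fun_prop) hne
  rw [hJ, ← intervalIntegral.integral_const_mul, ← intervalIntegral.integral_const_mul,
    ← intervalIntegral.integral_sub]
  · refine intervalIntegral.integral_congr fun t _ => ?_
    have hexp := exp_log_add_mul_I hR t
    rw [regularizedIntegrand_of_exp_ne hμ s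
      (by rw [hexp]; exact ofReal_mul_exp_I_mul_ne hμ hR h t), hexp]
    ring
  · exact Continuous.intervalIntegrable (by fun_prop) _ _
  · exact Continuous.intervalIntegrable (by fun_prop) _ _

theorem continuousOn_cpow_mul_inv_add {μ : ℝ} (hμ : 0 < μ) (s : ℂ) :
    ContinuousOn (fun ρ : ℝ => (ρ : ℂ) ^ s * ((μ : ℂ) + ρ)⁻¹) (Set.Ioi 0) := by
  intro ρ hρ
  have hρ' : (0 : ℝ) < ρ := hρ
  refine ContinuousAt.continuousWithinAt (ContinuousAt.mul ?_ (ContinuousAt.inv₀ (by fun_prop) ?_))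
  · exact Complex.continuousAt_ofReal_cpow_const ρ s (Or.inr hρ'.ne')
  · exact_mod_cast (add_pos hμ hρ').ne'

theorem integral_regularizedIntegrand_horizontal {μ r R : ℝ} (hμ : 0 < μ) (hr : 0 < r)
    (hR : 0 < R) (s : ℂ) :
    (∫ x in Real.log r..Real.log R, regularizedIntegrand μ s (x + ((-π : ℝ) : ℂ) * Complex.I)) -
      (∫ x in Real.log r..Real.log R, regularizedIntegrand μ s (x + (π : ℂ) * Complex.I)) =
      2 * Complex.I * Complex.sin (π * s) *
        ∫ ρ in r..R, (ρ : ℂ) ^ s * ((μ : ℂ) + ρ)⁻¹ := by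
  have hint : ∀ y : ℝ, |y| ≤ π → IntervalIntegrable
      (fun x : ℝ => regularizedIntegrand μ s (x + (y : ℂ) * Complex.I)) volume
      (Real.log r) (Real.log R) := by
    intro y hy
    refine Continuous.intervalIntegrable (continuous_iff_continuousAt.2 fun x => ?_) _ _
    exact ContinuousAt.comp (f := fun x : ℝ => (x : ℂ) + (y : ℂ) * Complex.I)
      (differentiableAt_regularizedIntegrand hμ s (by simpa using hy)).continuousAt (by fun_prop)
  have hsub := intervalIntegral.integral_deriv_smul_comp' (a := Real.log r) (b := Real.log R)
    (f := Real.exp) (f' := Real.exp) (g := fun ρ : ℝ => (ρ : ℂ) ^ s * ((μ : ℂ) + ρ)⁻¹)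
    (fun x _ => Real.hasDerivAt_exp x) Real.continuous_exp.continuousOn
    ((continuousOn_cpow_mul_inv_add hμ s).mono (by
      rintro _ ⟨x, -, rfl⟩
      exact Real.exp_pos x))
  rw [Real.exp_log hr, Real.exp_log hR] at hsub
  rw [← hsub, ← intervalIntegral.integral_sub (hint (-π) (by simp [abs_of_pos Real.pi_pos]))
    (hint π (abs_of_pos Real.pi_pos).le), ← intervalIntegral.integral_const_mul]
  refine intervalIntegral.integral_congr fun x _ => ?_
  have hpos : (μ : ℂ) + Complex.exp x ≠ 0 := by
    rw [← Complex.ofReal_exp]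
    exact_mod_cast (add_pos hμ (Real.exp_pos x)).ne'
  have h1 : Complex.exp ((x : ℂ) + (π : ℂ) * Complex.I) = -Complex.exp x := by
    rw [Complex.exp_add, Complex.exp_pi_mul_I, mul_neg_one]
  have h2 : Complex.exp ((x : ℂ) + ((-π : ℝ) : ℂ) * Complex.I) = -Complex.exp x := by
    rw [Complex.exp_add, Complex.ofReal_neg, neg_mul, Complex.exp_neg_pi_mul_I, mul_neg_one]
  have hne : -Complex.exp x ≠ (μ : ℂ) := fun h => hpos (by rw [← h]; ring)
  have hpow : ((Real.exp x : ℝ) : ℂ) ^ s = Complex.exp (s * x) := by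
    rw [Complex.cpow_def_of_ne_zero (by exact_mod_cast (Real.exp_pos x).ne'),
      ← Complex.ofReal_log (Real.exp_pos x).le, Real.log_exp, mul_comm]
  simp only [Function.comp_apply]
  rw [regularizedIntegrand_of_exp_ne hμ s (by rwa [h2]),
    regularizedIntegrand_of_exp_ne hμ s (by rwa [h1]), h1, h2, hpow, sub_neg_eq_add,
    Complex.sin, Complex.real_smul, Complex.ofReal_exp,
    show s * ((x : ℂ) + ((-π : ℝ) : ℂ) * Complex.I) = s * x + -(π * s) * Complex.I by
      push_cast; ring,
    show s * ((x : ℂ) + (π : ℂ) * Complex.I) = s * x + π * s * Complex.I by ring,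
    Complex.exp_add, Complex.exp_add]
  linear_combination (-(Complex.exp (-(π * s) * Complex.I) - Complex.exp (π * s * Complex.I)) *
    Complex.exp (s * x) * Complex.exp x * ((μ : ℂ) + Complex.exp x)⁻¹) * Complex.I_mul_I

theorem cpow_eq_truncated_keyhole_integral {μ r R : ℝ} (hr : 0 < r) (hrμ : r < μ) (hμR : μ < R)
    (s : ℂ) :
    (-(Complex.sin ((π : ℂ) * s) / (π : ℂ))) *
        (∫ ρ in r..R, (ρ : ℂ) ^ s * ((μ : ℂ) + ρ)⁻¹)
      + ((r : ℂ) / (2 * (π : ℂ))) *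
        (∫ t in (-π : ℝ)..π,
          Complex.exp (Complex.I * t) * ((r : ℂ) * Complex.exp (Complex.I * t)) ^ s *
            ((μ : ℂ) - (r : ℂ) * Complex.exp (Complex.I * t))⁻¹)
      - ((R : ℂ) / (2 * (π : ℂ))) *
        (∫ t in (-π : ℝ)..π,
          Complex.exp (Complex.I * t) * ((R : ℂ) * Complex.exp (Complex.I * t)) ^ s *
            ((μ : ℂ) - (R : ℂ) * Complex.exp (Complex.I * t))⁻¹)
      = (μ : ℂ) ^ s := by
  have hμ := hr.trans hrμ
  have hR := hμ.trans hμR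
  have hrect := Complex.integral_boundary_rect_eq_zero_of_differentiableOn
    (regularizedIntegrand μ s) ⟨Real.log r, -π⟩ ⟨Real.log R, π⟩ (by
      intro w hw
      refine (differentiableAt_regularizedIntegrand hμ s ?_).differentiableWithinAt
      have h2 : w.im ∈ Set.uIcc (-π) π := hw.2
      rw [Set.uIcc_of_le (by linarith [Real.pi_pos])] at h2
      exact abs_le.2 h2)
  simp only at hrect
  rw [integral_regularizedIntegrand_horizontal hμ hr hR,
    integral_regularizedIntegrand_vertical hμ hr hrμ.ne,
    integral_regularizedIntegrand_vertical hμ hR hμR.ne',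
    integral_cauchyKernel_of_lt hr hrμ, integral_cauchyKernel_of_gt hμ hμR] at hrect
  have hπ : (π : ℂ) ≠ 0 := by exact_mod_cast Real.pi_ne_zero
  simp only [smul_eq_mul] at hrect
  generalize (∫ ρ in r..R, (ρ : ℂ) ^ s * ((μ : ℂ) + ρ)⁻¹) = A at hrect ⊢
  generalize (∫ t in (-π : ℝ)..π,
    Complex.exp (Complex.I * t) * ((r : ℂ) * Complex.exp (Complex.I * t)) ^ s *
      ((μ : ℂ) - (r : ℂ) * Complex.exp (Complex.I * t))⁻¹) = B at hrect ⊢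
  generalize (∫ t in (-π : ℝ)..π,
    Complex.exp (Complex.I * t) * ((R : ℂ) * Complex.exp (Complex.I * t)) ^ s *
      ((μ : ℂ) - (R : ℂ) * Complex.exp (Complex.I * t))⁻¹) = C at hrect ⊢
  field_simp
  refine mul_left_cancel₀ Complex.I_ne_zero ?_
  linear_combination -hrect

theorem tendsto_integral_large_circle {μ : ℝ} (hμ : 0 < μ) {s : ℂ} (hs : s.re < 0) :
    Filter.Tendsto (fun R : ℝ => ((R : ℂ) / (2 * (π : ℂ))) *
        (∫ t in (-π : ℝ)..π,
          Complex.exp (Complex.I * t) * ((R : ℂ) * Complex.exp (Complex.I * t)) ^ s *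
            ((μ : ℂ) - (R : ℂ) * Complex.exp (Complex.I * t))⁻¹))
      Filter.atTop (nhds 0) := by
  have hlim : Filter.Tendsto (fun R : ℝ => 2 * Real.exp (|s.im| * π) * R ^ s.re)
      Filter.atTop (nhds 0) := by
    have := (tendsto_rpow_neg_atTop (neg_pos.2 hs)).const_mul (2 * Real.exp (|s.im| * π))
    simpa using this
  refine squeeze_zero_norm' ?_ hlim
  filter_upwards [Filter.eventually_ge_atTop (2 * μ)] with R hR
  have hR0 : 0 < R := by linarith
  have hbound : ∀ t ∈ Set.uIoc (-π) π,
      ‖Complex.exp (Complex.I * t) * ((R : ℂ) * Complex.exp (Complex.I * t)) ^ s *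
            ((μ : ℂ) - (R : ℂ) * Complex.exp (Complex.I * t))⁻¹‖ ≤
        R ^ s.re * Real.exp (|s.im| * π) * (2 / R) := by
    intro t ht
    rw [Set.uIoc_of_le (by linarith [Real.pi_pos])] at ht
    rw [cpow_ofReal_mul_exp_I_mul hR0 s ht, norm_mul, norm_mul, norm_inv, mul_comm Complex.I,
      Complex.norm_exp_ofReal_mul_I, one_mul, mul_comm (t : ℂ)]
    gcongr
    · rw [Complex.norm_exp, Real.rpow_def_of_pos hR0, ← Real.exp_add]
      refine Real.exp_le_exp.2 ?_
      have h1 : -(s.im * t) ≤ |s.im| * π := by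
        calc -(s.im * t) ≤ |s.im * t| := neg_le_abs _
          _ = |s.im| * |t| := abs_mul _ _
          _ ≤ |s.im| * π := by gcongr; exact abs_le.2 ⟨ht.1.le, ht.2⟩
      simp
      linarith
    · have h1 : R - μ ≤ ‖(μ : ℂ) - (R : ℂ) * Complex.exp (Complex.I * t)‖ := by
        have := norm_sub_norm_le ((R : ℂ) * Complex.exp (Complex.I * t)) (μ : ℂ)
        rwa [norm_ofReal_mul_exp_I_mul hR0, Complex.norm_real, Real.norm_of_nonneg hμ.le,
          norm_sub_rev] at this
      rw [show 2 / R = (R / 2)⁻¹ by rw [inv_div]]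
      exact inv_anti₀ (by positivity) (by linarith)
  have hI := intervalIntegral.norm_integral_le_of_norm_le_const hbound
  rw [sub_neg_eq_add, abs_of_pos (add_pos Real.pi_pos Real.pi_pos)] at hI
  have hn : ‖(R : ℂ) / (2 * (π : ℂ))‖ = R / (2 * π) := by
    simp [abs_of_pos hR0, abs_of_pos Real.pi_pos]
  rw [norm_mul, hn]
  refine (mul_le_mul_of_nonneg_left hI (by positivity)).trans (le_of_eq ?_)
  have := Real.pi_ne_zero
  field_simp
  ring

theorem integrableOn_Ioi_cpow_mul_inv_add {μ r : ℝ} (hμ : 0 < μ) (hr : 0 < r) {s : ℂ}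
    (hs : s.re < 0) :
    IntegrableOn (fun ρ : ℝ => (ρ : ℂ) ^ s * ((μ : ℂ) + ρ)⁻¹) (Set.Ioi r) := by
  have hdom : IntegrableOn (fun ρ : ℝ => (ρ : ℂ) ^ (s - 1)) (Set.Ioi r) :=
    integrableOn_Ioi_cpow_of_lt (by rw [Complex.sub_re, Complex.one_re]; linarith) hr
  refine Integrable.mono hdom (((continuousOn_cpow_mul_inv_add hμ s).mono
    (Set.Ioi_subset_Ioi hr.le)).aestronglyMeasurable measurableSet_Ioi) ?_
  filter_upwards [ae_restrict_mem measurableSet_Ioi] with ρ hρ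
  have hρ0 : 0 < ρ := hr.trans hρ
  rw [Complex.cpow_sub _ _ (by exact_mod_cast hρ0.ne'), Complex.cpow_one, div_eq_mul_inv,
    norm_mul, norm_mul, norm_inv, norm_inv, ← Complex.ofReal_add, Complex.norm_real,
    Complex.norm_real, Real.norm_of_nonneg (by positivity), Real.norm_of_nonneg hρ0.le]
  gcongr
  linarith

/-- Scalar content of Seeley's contour-integral formula for complex powers:
for `μ > 0`, `0 < r < μ` and `Re s < 0`, the keyhole contour integral
`(i/2π) ∫_{Γ_r} λ^s (μ - λ)⁻¹ dλ`, parametrized explicitly, equals `μ^s`. -/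
theorem stmt0 (μ r : ℝ) (hμ : 0 < μ) (hr0 : 0 < r) (hrμ : r < μ)
    (s : ℂ) (hs : s.re < 0) :
    IntegrableOn (fun ρ : ℝ => (ρ : ℂ) ^ s * ((μ : ℂ) + ρ)⁻¹) (Set.Ioi r) ∧
    (-(Complex.sin ((π : ℂ) * s) / (π : ℂ))) *
        (∫ ρ in Set.Ioi r, (ρ : ℂ) ^ s * ((μ : ℂ) + ρ)⁻¹)
      + ((r : ℂ) / (2 * (π : ℂ))) *
        (∫ t in (-π : ℝ)..π,
          Complex.exp (Complex.I * t) * ((r : ℂ) * Complex.exp (Complex.I * t)) ^ s *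
            ((μ : ℂ) - (r : ℂ) * Complex.exp (Complex.I * t))⁻¹)
      = (μ : ℂ) ^ s := by
  refine ⟨integrableOn_Ioi_cpow_mul_inv_add hμ hr0 hs, ?_⟩
  have hI := intervalIntegral_tendsto_integral_Ioi r
    (integrableOn_Ioi_cpow_mul_inv_add hμ hr0 hs) Filter.tendsto_id
  have hlim := ((hI.const_mul (-(Complex.sin ((π : ℂ) * s) / (π : ℂ)))).add_const
    (((r : ℂ) / (2 * (π : ℂ))) *
        (∫ t in (-π : ℝ)..π,
          Complex.exp (Complex.I * t) * ((r : ℂ) * Complex.exp (Complex.I * t)) ^ s *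
            ((μ : ℂ) - (r : ℂ) * Complex.exp (Complex.I * t))⁻¹))).sub
    (tendsto_integral_large_circle hμ hs)
  rw [sub_zero] at hlim
  refine tendsto_nhds_unique hlim (tendsto_const_nhds.congr' ?_)
  filter_upwards [Filter.eventually_gt_atTop μ] with R hR
  exact (cpow_eq_truncated_keyhole_integral hr0 hrμ hR s).symm
end

section
/- Let R > 0 and let q : ℂ → ℂ be holomorphic on the open disc {λ ∈ ℂ : |λ| < R}. Then for every s ∈ ℂ and all real numbers r, r' with 0 < r ≤ r' < R one has −(sin(πs)/π)·∫_r^{r'} ρ^s q(−ρ) dρ + (r/(2π))·∫_{−π}^{π} e^{it} (r e^{it})^s q(r e^{it}) dt = (r'/(2π))·∫_{−π}^{π} e^{it} (r' e^{it})^s q(r' e^{it}) dt, where (z)^s denotes the principal complex power and ρ^s = exp(s log ρ) for ρ > 0. -/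
open MeasureTheory
open scoped Real

/-- In logarithmic coordinates `λ = e ^ w`, the form `λ ^ s q(λ) dλ` becomes
`keyholeIntegrand q s w dw`. -/
noncomputable def keyholeIntegrand (q : ℂ → ℂ) (s w : ℂ) : ℂ :=
  Complex.exp (w * (s + 1)) * q (Complex.exp w)

lemma keyholeIntegrand_log_add_mul_I (q : ℂ → ℂ) (s : ℂ) {ρ : ℝ} (hρ : 0 < ρ) {t : ℝ}
    (ht : t ∈ Set.Ioc (-π) π) :
    keyholeIntegrand q s ((Real.log ρ : ℝ) + t * Complex.I) =
      ρ * (Complex.exp (Complex.I * t) * ((ρ : ℂ) * Complex.exp (Complex.I * t)) ^ s *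
        q ((ρ : ℂ) * Complex.exp (Complex.I * t))) := by
  have hexp : Complex.exp ((Real.log ρ : ℝ) + t * Complex.I) =
      ρ * Complex.exp (Complex.I * t) := by
    rw [Complex.exp_add, ← Complex.ofReal_exp, Real.exp_log hρ, mul_comm (t : ℂ)]
  have hpow : ((ρ : ℂ) * Complex.exp (Complex.I * t)) ^ s =
      Complex.exp (((Real.log ρ : ℝ) + t * Complex.I) * s) := by
    rw [← hexp, Complex.cpow_def_of_ne_zero (Complex.exp_ne_zero _),
      Complex.log_exp (by simpa using ht.1) (by simpa using ht.2)]
  rw [keyholeIntegrand, hpow, mul_add, mul_one, Complex.exp_add, hexp]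
  ring

lemma integral_keyholeIntegrand_arc (q : ℂ → ℂ) (s : ℂ) {ρ : ℝ} (hρ : 0 < ρ) :
    ∫ t in (-π : ℝ)..π, keyholeIntegrand q s ((Real.log ρ : ℝ) + t * Complex.I) =
      ρ * ∫ t in (-π : ℝ)..π,
        Complex.exp (Complex.I * t) * ((ρ : ℂ) * Complex.exp (Complex.I * t)) ^ s *
          q ((ρ : ℂ) * Complex.exp (Complex.I * t)) := by
  rw [← intervalIntegral.integral_const_mul]
  exact intervalIntegral.integral_congr_Ioo_of_le (by linarith [Real.pi_pos]) fun t ht =>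
    keyholeIntegrand_log_add_mul_I q s hρ (Set.Ioo_subset_Ioc_self ht)

lemma integral_keyholeIntegrand_ray (q : ℂ → ℂ) (s : ℂ) {r r' : ℝ} (hr : 0 < r) (hr' : 0 < r')
    {θ : ℝ} (hθ : Complex.exp (θ * Complex.I) = -1) :
    ∫ x in Real.log r..Real.log r', keyholeIntegrand q s (x + θ * Complex.I) =
      -Complex.exp (θ * Complex.I * s) * ∫ ρ in r..r', (ρ : ℂ) ^ s * q (-ρ) := by
  have hsub := intervalIntegral.integral_deriv_smul_comp_of_deriv_nonneg
    (a := Real.log r) (b := Real.log r') (f := Real.exp) (f' := Real.exp)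
    (g := fun ρ : ℝ => (ρ : ℂ) ^ s * q (-ρ)) Real.continuous_exp.continuousOn
    (fun x _ => Real.hasDerivAt_exp x) (fun x _ => (Real.exp_pos x).le)
  rw [Real.exp_log hr, Real.exp_log hr'] at hsub
  rw [← hsub, ← intervalIntegral.integral_const_mul]
  refine intervalIntegral.integral_congr fun x _ => ?_
  have hpow : (Complex.exp x) ^ s = Complex.exp (x * s) := by
    rw [Complex.cpow_def_of_ne_zero (Complex.exp_ne_zero _),
      Complex.log_exp (by simpa using Real.pi_pos) (by simpa using Real.pi_pos.le)]
  simp only [keyholeIntegrand, Function.comp_apply, Complex.real_smul, Complex.ofReal_exp, hpow,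
    mul_add, add_mul, mul_one, Complex.exp_add, hθ]
  ring_nf

lemma differentiableOn_keyholeIntegrand {R : ℝ} {q : ℂ → ℂ}
    (hq : DifferentiableOn ℂ q (Metric.ball (0 : ℂ) R)) (s : ℂ) :
    DifferentiableOn ℂ (keyholeIntegrand q s) {w | Real.exp w.re < R} := by
  refine DifferentiableOn.mul (by fun_prop) (hq.comp (by fun_prop) fun w hw => ?_)
  simpa [Complex.norm_exp] using hw

/-- Independence of Seeley's keyhole contour integral `(i/2π) ∫_{Γ_r} λ^s q(λ) dλ` of the
radius: if `q` is holomorphic on the disc of radius `R` around `0` and `0 < r ≤ r' < R`,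
deforming the contour from radius `r` to radius `r'` exchanges the circle contribution
against the portion of the two rays between `r` and `r'`. -/
theorem stmt4 (R : ℝ) (hR : 0 < R) (q : ℂ → ℂ)
    (hq : DifferentiableOn ℂ q (Metric.ball (0 : ℂ) R))
    (s : ℂ) (r r' : ℝ) (hr : 0 < r) (hrr' : r ≤ r') (hr'R : r' < R) :
    (-(Complex.sin ((π : ℂ) * s) / (π : ℂ))) * (∫ ρ in r..r', (ρ : ℂ) ^ s * q (-ρ))
      + ((r : ℂ) / (2 * (π : ℂ))) *
        (∫ t in (-π : ℝ)..π,
          Complex.exp (Complex.I * t) * ((r : ℂ) * Complex.exp (Complex.I * t)) ^ s *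
            q ((r : ℂ) * Complex.exp (Complex.I * t)))
      = ((r' : ℂ) / (2 * (π : ℂ))) *
        (∫ t in (-π : ℝ)..π,
          Complex.exp (Complex.I * t) * ((r' : ℂ) * Complex.exp (Complex.I * t)) ^ s *
            q ((r' : ℂ) * Complex.exp (Complex.I * t))) := by
  have hr' : 0 < r' := hr.trans_le hrr'
  have hlog : Real.log r ≤ Real.log r' := Real.log_le_log hr hrr'
  have hrect := Complex.integral_boundary_rect_eq_zero_of_differentiableOn
    (keyholeIntegrand q s) ⟨Real.log r, -π⟩ ⟨Real.log r', π⟩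
    ((differentiableOn_keyholeIntegrand hq s).mono fun w hw => by
      have hre : w.re ≤ Real.log r' := (Set.uIcc_of_le hlog ▸ hw.1).2
      exact ((Real.le_log_iff_exp_le hr').1 hre).trans_lt hr'R)
  dsimp only at hrect
  rw [integral_keyholeIntegrand_arc q s hr, integral_keyholeIntegrand_arc q s hr',
    integral_keyholeIntegrand_ray q s hr hr' Complex.exp_pi_mul_I,
    integral_keyholeIntegrand_ray q s hr hr' (by simp [Complex.exp_neg, Complex.exp_pi_mul_I])]
    at hrect
  have hsin : Complex.exp (π * Complex.I * s) - Complex.exp ((-π : ℝ) * Complex.I * s) =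
      2 * Complex.I * Complex.sin (π * s) := by
    rw [Complex.sin, show (π : ℂ) * Complex.I * s = π * s * Complex.I by ring,
      show ((-π : ℝ) : ℂ) * Complex.I * s = -(π * s) * Complex.I by push_cast; ring]
    linear_combination (Complex.exp (π * s * Complex.I) - Complex.exp (-(π * s) * Complex.I)) *
      Complex.I_sq
  have hpi : (π : ℂ) ≠ 0 := Complex.ofReal_ne_zero.2 Real.pi_ne_zero
  simp only [smul_eq_mul] at hrect
  generalize (∫ ρ in r..r', (ρ : ℂ) ^ s * q (-ρ)) = J at hrect ⊢
  generalize (∫ t in (-π : ℝ)..π, Complex.exp (Complex.I * t) *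
    ((r : ℂ) * Complex.exp (Complex.I * t)) ^ s *
      q ((r : ℂ) * Complex.exp (Complex.I * t))) = A at hrect ⊢
  generalize (∫ t in (-π : ℝ)..π, Complex.exp (Complex.I * t) *
    ((r' : ℂ) * Complex.exp (Complex.I * t)) ^ s *
      q ((r' : ℂ) * Complex.exp (Complex.I * t))) = B at hrect ⊢
  have hsum : 2 * Complex.sin (π * s) * J + r' * B - r * A = 0 :=
    mul_left_cancel₀ Complex.I_ne_zero (by linear_combination hrect - J * hsin)
  field_simp
  linear_combination -hsum
end

section
/- Let V be a real vector space of finite dimension 2n with n ≥ 1, and let ω be an element of the second exterior power ⋀²V, viewed inside the exterior algebra ⋀V, such that the n-fold product ω ∧ ⋯ ∧ ω (n factors) is nonzero in ⋀^{2n}V. Then for every k with 0 ≤ k ≤ n − 1, the linear map from ⋀^k V to ⋀^{k+2} V given by x ↦ ω ∧ x is injective. -/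
namespace ExteriorAlgebra

open CliffordAlgebra (contractLeft)

variable {R M : Type*} [CommRing R] [AddCommGroup M] [Module R M]

/-- Contraction by `d` on the exterior algebra acts as an antiderivation. -/
theorem contractLeft_ι_mul (d : Module.Dual R M) (a : M) (y : ExteriorAlgebra R M) :
    contractLeft d (ι R a * y) = d a • y - ι R a * contractLeft d y :=
  CliffordAlgebra.contractLeft_ι_mul d a y

theorem ι_mul_ι_anticomm (a b : M) : ι R a * ι R b = -(ι R b * ι R a) :=
  eq_neg_of_add_eq_zero_left (ι_add_mul_swap a b)

/-- Elements of degree two are central. -/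
theorem commute_of_mem_exteriorPower_two {ω : ExteriorAlgebra R M} (hω : ω ∈ ⋀[R]^2 M)
    (x : ExteriorAlgebra R M) : Commute ω x := by
  rw [exteriorPower, pow_two] at hω
  induction hω using Submodule.mul_induction_on' with
  | mem_mul_mem _ ha _ hb =>
    obtain ⟨a, rfl⟩ := ha
    obtain ⟨b, rfl⟩ := hb
    induction x using ExteriorAlgebra.induction with
    | algebraMap r => exact (Algebra.commutes r _).symm
    | ι v =>
      rw [Commute, SemiconjBy, mul_assoc, ι_mul_ι_anticomm b v, mul_neg, ← mul_assoc,
        ι_mul_ι_anticomm a v, neg_mul, neg_neg, mul_assoc]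
    | mul _ _ hx hy => exact hx.mul_right hy
    | add _ _ hx hy => exact hx.add_right hy
  | add _ _ _ _ hx hy => exact hx.add_left hy

/-- Contraction satisfies the ungraded Leibniz rule for products with elements of degree two. -/
theorem contractLeft_mul_of_mem_exteriorPower_two (d : Module.Dual R M)
    {ω : ExteriorAlgebra R M} (hω : ω ∈ ⋀[R]^2 M) (y : ExteriorAlgebra R M) :
    contractLeft d (ω * y) = contractLeft d ω * y + ω * contractLeft d y := by
  rw [exteriorPower, pow_two] at hω
  induction hω using Submodule.mul_induction_on' with
  | mem_mul_mem _ ha _ hb =>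
    obtain ⟨a, rfl⟩ := ha
    obtain ⟨b, rfl⟩ := hb
    have hb : contractLeft d (ι R b) = algebraMap R (ExteriorAlgebra R M) (d b) :=
      CliffordAlgebra.contractLeft_ι _ d b
    rw [mul_assoc, contractLeft_ι_mul, contractLeft_ι_mul, contractLeft_ι_mul, hb,
      ← Algebra.commutes, ← Algebra.smul_def]
    simp only [mul_sub, sub_mul, smul_mul_assoc, mul_smul_comm, mul_assoc]
    abel
  | add _ _ _ _ hx hy =>
    simp only [add_mul, map_add, hx, hy]
    abel

theorem exists_mul_contractLeft_pow_mul (d : Module.Dual R M) {ω : ExteriorAlgebra R M}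
    (hω : ω ∈ ⋀[R]^2 M) (y : ExteriorAlgebra R M) (m : ℕ) :
    ∃ z, ω * contractLeft d (ω ^ m * y) = ω ^ (m + 1) * contractLeft d y + z * (ω ^ m * y) := by
  induction m with
  | zero => exact ⟨0, by simp⟩
  | succ m ih =>
    obtain ⟨z, hz⟩ := ih
    refine ⟨contractLeft d ω + z, ?_⟩
    rw [pow_succ', mul_assoc, contractLeft_mul_of_mem_exteriorPower_two d hω, hz, mul_add, mul_add,
      ← mul_assoc ω (contractLeft d ω), (commute_of_mem_exteriorPower_two hω _).eq,
      ← mul_assoc ω z, (commute_of_mem_exteriorPower_two hω z).eq, add_mul, pow_succ' ω (m + 1)]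
    simp only [mul_assoc]
    abel

theorem contractLeft_mem_exteriorPower (d : Module.Dual R M) {k : ℕ} {x : ExteriorAlgebra R M}
    (hx : x ∈ ⋀[R]^(k + 1) M) : contractLeft d x ∈ ⋀[R]^k M := by
  induction k generalizing x with
  | zero =>
    rw [exteriorPower, zero_add, pow_one] at hx
    obtain ⟨a, rfl⟩ := hx
    rw [exteriorPower, pow_zero]
    exact Submodule.mem_one.2 ⟨d a, (CliffordAlgebra.contractLeft_ι _ d a).symm⟩
  | succ k ih =>
    rw [exteriorPower, pow_succ'] at hx
    induction hx using Submodule.mul_induction_on' with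
    | mem_mul_mem _ ha y hy =>
      obtain ⟨a, rfl⟩ := ha
      rw [contractLeft_ι_mul]
      refine sub_mem (Submodule.smul_mem _ _ hy) ?_
      rw [exteriorPower, pow_succ']
      exact Submodule.mul_mem_mul ⟨a, rfl⟩ (ih hy)
    | add _ _ _ _ hx hy =>
      rw [map_add]
      exact add_mem hx hy

/-- Euler's identity in the exterior algebra. -/
theorem sum_ι_mul_contractLeft_coord {I : Type*} [Fintype I] (b : Module.Basis I R M) {k : ℕ}
    {x : ExteriorAlgebra R M} (hx : x ∈ ⋀[R]^k M) :
    ∑ i, ι R (b i) * contractLeft (b.coord i) x = k • x := by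
  induction k generalizing x with
  | zero =>
    rw [exteriorPower, pow_zero] at hx
    obtain ⟨r, rfl⟩ := Submodule.mem_one.1 hx
    have h (i : I) : contractLeft (b.coord i) (algebraMap R (ExteriorAlgebra R M) r) = 0 :=
      CliffordAlgebra.contractLeft_algebraMap _ (b.coord i) r
    simp [h]
  | succ k ih =>
    rw [exteriorPower, pow_succ'] at hx
    induction hx using Submodule.mul_induction_on' with
    | mem_mul_mem _ ha y hy =>
      obtain ⟨a, rfl⟩ := ha
      have h (i : I) : ι R (b i) * contractLeft (b.coord i) (ι R a * y) =
          ι R (b.repr a i • b i) * y + ι R a * (ι R (b i) * contractLeft (b.coord i) y) := by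
        rw [contractLeft_ι_mul, mul_sub, ← mul_assoc, ι_mul_ι_anticomm (b i) a, neg_mul,
          sub_neg_eq_add, mul_assoc, map_smul, smul_mul_assoc, mul_smul_comm,
          Module.Basis.coord_apply]
      simp_rw [h]
      rw [Finset.sum_add_distrib, ← Finset.sum_mul, ← Finset.mul_sum, ih hy, ← map_sum, b.sum_repr,
        mul_smul_comm, succ_nsmul']
    | add _ _ _ _ hx hy => simp only [map_add, mul_add, Finset.sum_add_distrib, hx, hy, smul_add]

/-- If `ω` has degree two and `ω ^ (m + k) ≠ 0`, then multiplication by `ω ^ m` is injective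
in degree `k`. -/
theorem eq_zero_of_pow_mul_eq_zero {K V : Type*} [Field K] [CharZero K] [AddCommGroup V]
    [Module K V] [FiniteDimensional K V] {ω : ExteriorAlgebra K V} (hω : ω ∈ ⋀[K]^2 V)
    {m k : ℕ} (h : ω ^ (m + k) ≠ 0) {x : ExteriorAlgebra K V} (hx : x ∈ ⋀[K]^k V)
    (h0 : ω ^ m * x = 0) : x = 0 := by
  induction k generalizing m x with
  | zero =>
    rw [exteriorPower, pow_zero] at hx
    obtain ⟨r, rfl⟩ := Submodule.mem_one.1 hx
    rw [← Algebra.commutes, ← Algebra.smul_def] at h0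
    rw [(smul_eq_zero.1 h0).resolve_right h, map_zero]
  | succ k ih =>
    have hd (d : Module.Dual K V) : contractLeft d x = 0 := by
      refine ih (m := m + 1) (by rwa [add_right_comm, add_assoc])
        (contractLeft_mem_exteriorPower d hx) ?_
      obtain ⟨z, hz⟩ := exists_mul_contractLeft_pow_mul d hω x m
      simpa [h0] using hz.symm
    have := sum_ι_mul_contractLeft_coord (Module.finBasis K V) hx
    simp only [hd, mul_zero, Finset.sum_const_zero] at this
    rw [← Nat.cast_smul_eq_nsmul K] at this
    exact (smul_eq_zero.1 this.symm).resolve_left (Nat.cast_ne_zero.2 k.succ_ne_zero)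

end ExteriorAlgebra


/-- Lefschetz-type injectivity: if `V` is a real vector space of dimension `2n` and
`ω ∈ ⋀²V` satisfies `ω^n ≠ 0` (nondegeneracy), then for `0 ≤ k ≤ n - 1` the exterior
multiplication `⋀^k V → ⋀^{k+2} V`, `x ↦ ω ∧ x`, is injective. -/
theorem stmt8 (n : ℕ) (hn : 1 ≤ n) (V : Type*) [AddCommGroup V] [Module ℝ V]
    [FiniteDimensional ℝ V] (hdim : Module.finrank ℝ V = 2 * n)
    (ω : ExteriorAlgebra ℝ V) (hω : ω ∈ ⋀[ℝ]^2 V) (hnd : ω ^ n ≠ 0) :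
    ∀ k : ℕ, k ≤ n - 1 →
      Set.InjOn (fun x => ω * x)
        ((⋀[ℝ]^k V : Submodule ℝ (ExteriorAlgebra ℝ V)) : Set (ExteriorAlgebra ℝ V)) := by
  intro k hk x hx y hy hxy
  rw [← sub_eq_zero]
  refine ExteriorAlgebra.eq_zero_of_pow_mul_eq_zero hω (m := n - k) (k := k)
    (by rwa [Nat.sub_add_cancel (by omega)]) (sub_mem hx hy) ?_
  have h : ω * (x - y) = 0 := by rw [mul_sub]; exact sub_eq_zero.2 hxy
  obtain ⟨j, hj⟩ : ∃ j, n - k = j + 1 := ⟨n - k - 1, by omega⟩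
  rw [hj, pow_succ, mul_assoc, h, mul_zero]
end
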